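/- Suppose p > p_S. Then there is no function u ∈ C²((0,∞)) such that u''(s) + ((N−1)/s)u'(s) + f(u(s)) = 0 for all s > 0, u(s) > 0 for all s > 0, s^θ u(s) → A as s → 0⁺ (i.e. u(s) = A s^{−θ}(1+o(1)) as s ↓ 0), and u(s) → 0 as s → ∞. -/

import Mathlib

open Real Set Filter Topology MeasureTheory

noncomputable section

/-- The nonlinearity `f(u) = -u + u^p`. -/
def fNL (p u : ℝ) : ℝ := -u + u ^ p

/-- The Sobolev critical exponent `p_S = (N+2)/(N-2)`. -/
def pSob (N : ℕ) : ℝ := ((N : ℝ) + 2) / ((N : ℝ) - 2)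

/-- `θ = 2/(p-1)`. -/
def thetaP (p : ℝ) : ℝ := 2 / (p - 1)

/-- `A = (θ(N-2-θ))^{1/(p-1)}`. -/
def Aconst (N : ℕ) (p : ℝ) : ℝ :=
  (thetaP p * ((N : ℝ) - 2 - thetaP p)) ^ (1 / (p - 1))

/-- `m = (θ(N-2-θ))^{-1/2}`. -/
def mConst (N : ℕ) (p : ℝ) : ℝ :=
  (thetaP p * ((N : ℝ) - 2 - thetaP p)) ^ (-(1 / 2) : ℝ)

/-- `α = m(N-2-2θ)`. -/
def alphaConst (N : ℕ) (p : ℝ) : ℝ :=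
  mConst N p * ((N : ℝ) - 2 - 2 * thetaP p)

/-- The condition `p < p_JL`, where `p_JL = 1 + 4/(N-4-2√(N-1))` for `N ≥ 11` and
`p_JL = ∞` for `N ≤ 10`. -/
def pJLcond (N : ℕ) (p : ℝ) : Prop :=
  11 ≤ N → p < 1 + 4 / ((N : ℝ) - 4 - 2 * Real.sqrt ((N : ℝ) - 1))

/-- `y` is a C² solution of `y'' + α y' - y + y^p - m² e^{2mt} y = 0` on `(-∞, T]`
with `y → 1` as `t → -∞`; `y'`, `y''` are its first and second derivatives. -/
def IsSingODEOn (N : ℕ) (p T : ℝ) (y y' y'' : ℝ → ℝ) : Prop :=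
  (∀ t ∈ Iic T, HasDerivWithinAt y (y' t) (Iic T) t) ∧
  (∀ t ∈ Iic T, HasDerivWithinAt y' (y'' t) (Iic T) t) ∧
  ContinuousOn y'' (Iic T) ∧
  (∀ t ∈ Iic T, y'' t + alphaConst N p * y' t - y t + y t ^ p
      - (mConst N p) ^ 2 * Real.exp (2 * mConst N p * t) * y t = 0) ∧
  Tendsto y atBot (𝓝 1)

/-- `y` is a C² solution of `y'' + α y' - y + y^p - m² e^{2mt} y = 0` on all of `ℝ`
with `y → 1` as `t → -∞`. -/
def IsEntireSingODE (N : ℕ) (p : ℝ) (y y' y'' : ℝ → ℝ) : Prop :=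
  (∀ t : ℝ, HasDerivAt y (y' t) t) ∧
  (∀ t : ℝ, HasDerivAt y' (y'' t) t) ∧
  Continuous y'' ∧
  (∀ t : ℝ, y'' t + alphaConst N p * y' t - y t + y t ^ p
      - (mConst N p) ^ 2 * Real.exp (2 * mConst N p * t) * y t = 0) ∧
  Tendsto y atBot (𝓝 1)

/-- The singular solution `u*(s) = A s^{-θ} y*(m⁻¹ log s)` built from `y*`. -/
def ustar (N : ℕ) (p : ℝ) (y : ℝ → ℝ) (s : ℝ) : ℝ :=
  Aconst N p * s ^ (-(thetaP p)) * y (Real.log s / mConst N p)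

/-- `u` is a C² solution on `[0,∞)` of the IVP `u'' + ((N-1)/s)u' + f(u) = 0`,
`u(0) = γ`, `u'(0) = 0`, with nonlinearity `f(u) = -u + u^p`. -/
def IsIVPSol (N : ℕ) (p γ : ℝ) (u u' u'' : ℝ → ℝ) : Prop :=
  (∀ s ∈ Ici (0:ℝ), HasDerivWithinAt u (u' s) (Ici 0) s) ∧
  (∀ s ∈ Ici (0:ℝ), HasDerivWithinAt u' (u'' s) (Ici 0) s) ∧
  ContinuousOn u'' (Ici 0) ∧
  u 0 = γ ∧ u' 0 = 0 ∧
  (∀ s > (0:ℝ), u'' s + ((N : ℝ) - 1) / s * u' s + fNL p (u s) = 0)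

/-- `u` is a C² solution on `[0,∞)` of the IVP `u'' + ((N-1)/ρ)u' + u^p = 0`,
`u(0) = γ`, `u'(0) = 0`. -/
def IsBarSol (N : ℕ) (p γ : ℝ) (u u' u'' : ℝ → ℝ) : Prop :=
  (∀ ρ ∈ Ici (0:ℝ), HasDerivWithinAt u (u' ρ) (Ici 0) ρ) ∧
  (∀ ρ ∈ Ici (0:ℝ), HasDerivWithinAt u' (u'' ρ) (Ici 0) ρ) ∧
  ContinuousOn u'' (Ici 0) ∧
  u 0 = γ ∧ u' 0 = 0 ∧
  (∀ ρ > (0:ℝ), u'' ρ + ((N : ℝ) - 1) / ρ * u' ρ + u ρ ^ p = 0)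

/-- `s` is the `(k+1)`-th positive critical point of a function whose derivative is `u'`:
`s` is a positive critical point having exactly `k` positive critical points below it. -/
def IsNthCritPt (u' : ℝ → ℝ) (k : ℕ) (s : ℝ) : Prop :=
  0 < s ∧ u' s = 0 ∧ {x : ℝ | 0 < x ∧ x < s ∧ u' x = 0}.encard = (k : ℕ∞)

/-- `U` is a positive C² radial solution of the Neumann problem
`U'' + ((N-1)/r)U' + λ f(U) = 0` on `(0,1)`, `U'(0) = U'(1) = 0`, `U > 0` on `[0,1]`. -/
def NeumannSol (N : ℕ) (p lam : ℝ) (U U' U'' : ℝ → ℝ) : Prop :=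
  (∀ r ∈ Icc (0:ℝ) 1, HasDerivWithinAt U (U' r) (Icc 0 1) r) ∧
  (∀ r ∈ Icc (0:ℝ) 1, HasDerivWithinAt U' (U'' r) (Icc 0 1) r) ∧
  ContinuousOn U'' (Icc 0 1) ∧
  (∀ r ∈ Ioo (0:ℝ) 1, U'' r + ((N : ℝ) - 1) / r * U' r + lam * fNL p (U r) = 0) ∧
  U' 0 = 0 ∧ U' 1 = 0 ∧ (∀ r ∈ Icc (0:ℝ) 1, 0 < U r)

/-- `(lam, U)` is a singular solution of the Neumann problem whose graph meets `1`
exactly `n` times: `U` is C² on `(0,1)`, continuous on `(0,1]`, `U'(1) = 0`, it solves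
`U'' + ((N-1)/r)U' + λ f(U) = 0` on `(0,1)`, satisfies the asymptotics
`U(r) = A(√λ r)^{-θ}(1+o(1))` as `r ↓ 0` (i.e. `r^θ U(r) → A λ^{-θ/2}`),
`U - 1` has exactly `n` zeros in `(0,1]`, and `U > 0` on `(0,1]`. -/
def SingBVPSol (N : ℕ) (p lam : ℝ) (n : ℕ) (U U' U'' : ℝ → ℝ) : Prop :=
  (∀ r ∈ Ioc (0:ℝ) 1, HasDerivWithinAt U (U' r) (Ioc 0 1) r) ∧
  (∀ r ∈ Ioo (0:ℝ) 1, HasDerivAt U' (U'' r) r) ∧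
  ContinuousOn U (Ioc 0 1) ∧
  ContinuousOn U'' (Ioo 0 1) ∧
  (∀ r ∈ Ioo (0:ℝ) 1, U'' r + ((N : ℝ) - 1) / r * U' r + lam * fNL p (U r) = 0) ∧
  U' 1 = 0 ∧
  Tendsto (fun r => r ^ thetaP p * U r) (𝓝[>] (0:ℝ))
    (𝓝 (Aconst N p * lam ^ (-(thetaP p) / 2))) ∧
  {r ∈ Ioc (0:ℝ) 1 | U r = 1}.encard = (n : ℕ∞) ∧
  (∀ r ∈ Ioc (0:ℝ) 1, 0 < U r)

/-- The Pohozaev function of `u` in dimension `n + 3`, with `u'` in the role of the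
derivative of `u`. -/
def pohozaev (n : ℕ) (p : ℝ) (u u' : ℝ → ℝ) (s : ℝ) : ℝ :=
  s ^ (n + 3) * (u' s ^ 2 / 2 - u s ^ 2 / 2 + u s ^ (p + 1) / (p + 1))
    + ((n : ℝ) + 1) / 2 * (s ^ (n + 2) * (u s * u' s))

lemma hasDerivAt_pohozaev {n : ℕ} {p : ℝ} (hp : 1 < p) {u u' u'' : ℝ → ℝ} {s : ℝ} (hs : 0 < s)
    (hu : HasDerivAt u (u' s) s) (hu' : HasDerivAt u' (u'' s) s)
    (hode : u'' s + ((n : ℝ) + 2) / s * u' s + fNL p (u s) = 0) (hpos : 0 < u s) :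
    HasDerivAt (pohozaev n p u u')
      (-(s ^ (n + 2) * (u s ^ 2 + (((n : ℝ) + 1) / 2 - (n + 3) / (p + 1)) * u s ^ (p + 1)))) s := by
  have hpow := hu.rpow_const (p := p + 1) (Or.inl hpos.ne')
  have h := ((hasDerivAt_pow (n + 3) s).mul ((((hu'.pow 2).div_const 2).sub
    ((hu.pow 2).div_const 2)).add (hpow.div_const (p + 1)))).add
    (((hasDerivAt_pow (n + 2) s).mul (hu.mul hu')).const_mul (((n : ℝ) + 1) / 2))
  refine h.congr_deriv ?_
  have hp1 : p + 1 ≠ 0 := by linarith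
  have e1 : u s ^ (p + 1) = u s ^ p * u s := by rw [rpow_add hpos, rpow_one]
  have e2 : p + 1 - 1 = p := by ring
  have e3 : u'' s = -(((n : ℝ) + 2) / s * u' s) + u s - u s ^ p := by
    unfold fNL at hode; linarith
  simp only [Pi.add_apply, Pi.sub_apply, Pi.mul_apply, Pi.pow_apply, e1, e2, e3,
    Nat.add_one_sub_one, Nat.cast_add, Nat.cast_ofNat]
  field_simp
  ring

lemma pohozaev_strictAntiOn {n : ℕ} {p : ℝ} (hp : 1 < p) (hsup : (n : ℝ) + 5 < (n + 1) * p)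
    {u u' u'' : ℝ → ℝ}
    (hu : ∀ s > (0:ℝ), HasDerivAt u (u' s) s)
    (hu' : ∀ s > (0:ℝ), HasDerivAt u' (u'' s) s)
    (hode : ∀ s > (0:ℝ), u'' s + ((n : ℝ) + 2) / s * u' s + fNL p (u s) = 0)
    (hpos : ∀ s > (0:ℝ), 0 < u s) : StrictAntiOn (pohozaev n p u u') (Ioi 0) := by
  have hd := fun s (hs : (0:ℝ) < s) =>
    hasDerivAt_pohozaev hp hs (hu s hs) (hu' s hs) (hode s hs) (hpos s hs)
  refine strictAntiOn_of_deriv_neg (convex_Ioi 0)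
    (fun s hs => (hd s hs).continuousAt.continuousWithinAt) fun s hs => ?_
  rw [interior_Ioi] at hs
  have hs0 : 0 < s := hs
  have hus := hpos s hs
  have hc : 0 < ((n : ℝ) + 1) / 2 - (n + 3) / (p + 1) := by
    rw [sub_pos, div_lt_div_iff₀ (by linarith) two_pos]
    linarith
  rw [(hd s hs).deriv, neg_lt_zero]
  positivity

/-- A lower bound for the Pohozaev function that does not involve the derivative. -/
lemma le_pohozaev {n : ℕ} {p : ℝ} (hp : 1 < p) {u u' : ℝ → ℝ} {s : ℝ} (hs : 1 ≤ s)
    (hpos : 0 < u s) :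
    -((1 / 2 + ((n : ℝ) + 1) ^ 2 / 8) * (s ^ (n + 3) * u s ^ 2)) ≤ pohozaev n p u u' s := by
  have hs0 : 0 < s := by linarith
  have h1 : 0 ≤ u s ^ (p + 1) / (p + 1) := by
    have : 0 < p + 1 := by linarith
    positivity
  have h2 : 0 ≤ s ^ (n + 1) * ((s * u' s + ((n : ℝ) + 1) / 2 * u s) ^ 2 / 2
      + ((n : ℝ) + 1) ^ 2 / 8 * (s ^ 2 - 1) * u s ^ 2 + s ^ 2 * (u s ^ (p + 1) / (p + 1))) := by
    have : 0 ≤ s ^ 2 - 1 := by nlinarith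
    positivity
  unfold pohozaev
  linear_combination h2

lemma deriv_nonpos_of_subharmonic_of_tendsto_zero {n : ℕ} {u u' u'' : ℝ → ℝ} {R : ℝ} (hR : 0 < R)
    (hu : ∀ s > (0:ℝ), HasDerivAt u (u' s) s)
    (hu' : ∀ s > (0:ℝ), HasDerivAt u' (u'' s) s)
    (hpos : ∀ s > (0:ℝ), 0 < u s)
    (hsub : ∀ s ≥ R, 0 ≤ u'' s + ((n : ℝ) + 2) / s * u' s)
    (hlim : Tendsto u atTop (𝓝 0)) : ∀ s ≥ R, u' s ≤ 0 := by
  have hmono : MonotoneOn (fun s => s ^ (n + 2) * u' s) (Ici R) := by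
    have hd : ∀ s ≥ R, HasDerivAt (fun s => s ^ (n + 2) * u' s)
        (s ^ (n + 2) * (u'' s + ((n : ℝ) + 2) / s * u' s)) s := by
      intro s hs
      have hs0 : 0 < s := hR.trans_le hs
      refine ((hasDerivAt_pow (n + 2) s).mul (hu' s hs0)).congr_deriv ?_
      simp only [Nat.add_one_sub_one, Nat.cast_add, Nat.cast_ofNat]
      field_simp
      ring
    refine monotoneOn_of_deriv_nonneg (convex_Ici R)
      (fun s hs => (hd s hs).continuousAt.continuousWithinAt)
      (fun s hs => (hd s (interior_subset hs)).differentiableAt.differentiableWithinAt)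
      fun s hs => ?_
    have hs' : R ≤ s := interior_subset hs
    have hs0 : 0 < s := hR.trans_le hs'
    rw [(hd s hs').deriv]
    exact mul_nonneg (by positivity) (hsub s hs')
  intro a ha
  by_contra! h
  have ha0 : 0 < a := hR.trans_le ha
  have hu'pos : ∀ s ≥ a, 0 < u' s := fun s hs => by
    have h1 : a ^ (n + 2) * u' a ≤ s ^ (n + 2) * u' s := hmono ha (ha.le.trans hs) hs
    have hs0 : 0 < s := ha0.trans_le hs
    have h2 : 0 < s ^ (n + 2) * u' s := lt_of_lt_of_le (by positivity) h1
    exact pos_of_mul_pos_right h2 (by positivity)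
  have humono : MonotoneOn u (Ici a) := by
    have hd : ∀ s ≥ a, HasDerivAt u (u' s) s := fun s hs => hu s (ha0.trans_le hs)
    refine monotoneOn_of_deriv_nonneg (convex_Ici a)
      (fun s hs => (hd s hs).continuousAt.continuousWithinAt)
      (fun s hs => (hd s (interior_subset hs)).differentiableAt.differentiableWithinAt)
      fun s hs => ?_
    have hs' : a ≤ s := interior_subset hs
    rw [(hd s hs').deriv]
    exact (hu'pos s hs').le
  have : u a ≤ 0 := ge_of_tendsto hlim <| by
    filter_upwards [eventually_ge_atTop a] with s hs
    exact humono self_mem_Ici hs hs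
  exact this.not_gt (hpos a ha0)

lemma exists_exp_decay {u u' u'' : ℝ → ℝ} {R : ℝ} (hR : 0 ≤ R)
    (hu : ∀ s ≥ R, HasDerivAt u (u' s) s)
    (hu' : ∀ s ≥ R, HasDerivAt u' (u'' s) s)
    (hneg : ∀ s ≥ R, u' s ≤ 0)
    (hconv : ∀ s ≥ R, u s / 4 ≤ u'' s)
    (hlim : Tendsto u atTop (𝓝 0)) : ∃ C, ∀ s ≥ R, u s ≤ C * exp (-(s / 2)) := by
  have hexp : ∀ s : ℝ, HasDerivAt (fun s => exp (s / 2)) (exp (s / 2) * (1 / 2)) s := fun s =>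
    ((hasDerivAt_id s).div_const 2).exp
  have hexp' : ∀ s : ℝ, HasDerivAt (fun s => exp (-(s / 2))) (exp (-(s / 2)) * -(1 / 2)) s :=
    fun s => ((hasDerivAt_id s).div_const 2).neg.exp
  have hmono : MonotoneOn (fun s => (u' s + u s / 2) * exp (-(s / 2))) (Ici R) := by
    have hd : ∀ s ≥ R, HasDerivAt (fun s => (u' s + u s / 2) * exp (-(s / 2)))
        ((u'' s - u s / 4) * exp (-(s / 2))) s := fun s hs => by
      refine (((hu' s hs).add ((hu s hs).div_const 2)).mul (hexp' s)).congr_deriv ?_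
      simp only [Pi.add_apply]
      ring
    refine monotoneOn_of_deriv_nonneg (convex_Ici R)
      (fun s hs => (hd s hs).continuousAt.continuousWithinAt)
      (fun s hs => (hd s (interior_subset hs)).differentiableAt.differentiableWithinAt)
      fun s hs => ?_
    have hs' : R ≤ s := interior_subset hs
    rw [(hd s hs').deriv]
    exact mul_nonneg (sub_nonneg.2 (hconv s hs')) (exp_pos _).le
  have hle : ∀ a ≥ R, u' a + u a / 2 ≤ 0 := by
    intro a ha
    by_contra! h
    have hc : 0 < (u' a + u a / 2) * exp (-(a / 2)) := mul_pos h (exp_pos _)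
    have hbd : 2 * ((u' a + u a / 2) * exp (-(a / 2))) ≤ 0 := ge_of_tendsto hlim <| by
      filter_upwards [eventually_ge_atTop a] with s hs
      have hsR : R ≤ s := ha.le.trans hs
      have h1 : (u' a + u a / 2) * exp (-(a / 2)) ≤ (u' s + u s / 2) * exp (-(s / 2)) :=
        hmono ha hsR hs
      have h2 : exp (-(s / 2)) ≤ 1 := exp_le_one_iff.2 (by linarith)
      have h3 : 0 < u' s + u s / 2 := pos_of_mul_pos_left (hc.trans_le h1) (exp_pos _).le
      have h4 := hneg s hsR
      nlinarith
    linarith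
  have hanti : AntitoneOn (fun s => u s * exp (s / 2)) (Ici R) := by
    have hd : ∀ s ≥ R, HasDerivAt (fun s => u s * exp (s / 2))
        ((u' s + u s / 2) * exp (s / 2)) s := fun s hs => by
      refine ((hu s hs).mul (hexp s)).congr_deriv ?_
      ring
    refine antitoneOn_of_deriv_nonpos (convex_Ici _)
      (fun s hs => (hd s hs).continuousAt.continuousWithinAt)
      (fun s hs => (hd s (interior_subset hs)).differentiableAt.differentiableWithinAt)
      fun s hs => ?_
    have hs' : R ≤ s := interior_subset hs
    rw [(hd s hs').deriv]
    exact mul_nonpos_of_nonpos_of_nonneg (hle s hs') (exp_pos _).le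
  refine ⟨u R * exp (R / 2), fun s hs => ?_⟩
  rw [exp_neg, ← div_eq_mul_inv, le_div_iff₀ (exp_pos _)]
  exact hanti self_mem_Ici hs hs

lemma eventually_le_exp_neg {n : ℕ} {p : ℝ} (hp : 1 < p) {u u' u'' : ℝ → ℝ}
    (hu : ∀ s > (0:ℝ), HasDerivAt u (u' s) s)
    (hu' : ∀ s > (0:ℝ), HasDerivAt u' (u'' s) s)
    (hode : ∀ s > (0:ℝ), u'' s + ((n : ℝ) + 2) / s * u' s + fNL p (u s) = 0)
    (hpos : ∀ s > (0:ℝ), 0 < u s)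
    (hlim : Tendsto u atTop (𝓝 0)) : ∃ C, ∀ᶠ s in atTop, u s ≤ C * exp (-(s / 2)) := by
  have hpow : Tendsto (fun s => u s ^ (p - 1)) atTop (𝓝 0) := by
    have := hlim.rpow_const (p := p - 1) (Or.inr (by linarith))
    rwa [zero_rpow (by linarith)] at this
  obtain ⟨R, hR0, hR⟩ : ∃ R > (0:ℝ), ∀ s ≥ R, u s ^ (p - 1) < 3 / 4 := by
    obtain ⟨R, hR⟩ := eventually_atTop.1
      (hpow.eventually_lt_const (show (0:ℝ) < 3 / 4 by norm_num))
    exact ⟨max R 1, by positivity, fun s hs => hR s ((le_max_left _ _).trans hs)⟩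
  have hlow : ∀ s ≥ R, u s / 4 ≤ u'' s + ((n : ℝ) + 2) / s * u' s := fun s hs => by
    have hs0 : 0 < s := hR0.trans_le hs
    have hus := hpos s hs0
    have h1 := hode s hs0
    have h2 : u s ^ p = u s ^ (p - 1) * u s := by
      rw [← rpow_add_one hus.ne', sub_add_cancel]
    have h3 := mul_le_mul_of_nonneg_right (hR s hs).le hus.le
    unfold fNL at h1
    linarith
  have hneg := deriv_nonpos_of_subharmonic_of_tendsto_zero hR0 hu hu' hpos
    (fun s hs => (by have := hpos s (hR0.trans_le hs); positivity : 0 ≤ u s / 4).trans (hlow s hs))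
    hlim
  have hconv : ∀ s ≥ R, u s / 4 ≤ u'' s := fun s hs => by
    have hs0 : 0 < s := hR0.trans_le hs
    have := mul_nonpos_of_nonneg_of_nonpos (a := ((n : ℝ) + 2) / s) (by positivity) (hneg s hs)
    linarith [hlow s hs]
  obtain ⟨C, hC⟩ := exists_exp_decay hR0.le (fun s hs => hu s (hR0.trans_le hs))
    (fun s hs => hu' s (hR0.trans_le hs)) hneg hconv hlim
  exact ⟨C, eventually_atTop.2 ⟨R, hC⟩⟩

lemma pohozaev_nonneg_of_decay {n : ℕ} {p : ℝ} (hp : 1 < p) {u u' : ℝ → ℝ}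
    (hanti : AntitoneOn (pohozaev n p u u') (Ioi 0))
    (hpos : ∀ s > (0:ℝ), 0 < u s)
    (hdec : ∃ C, ∀ᶠ s in atTop, u s ≤ C * exp (-(s / 2))) {x : ℝ} (hx : 0 < x) :
    0 ≤ pohozaev n p u u' x := by
  obtain ⟨C, hC⟩ := hdec
  have hlim : Tendsto (fun s : ℝ => -((1 / 2 + ((n : ℝ) + 1) ^ 2 / 8)
      * (C ^ 2 * (s ^ (n + 3) * exp (-s))))) atTop (𝓝 0) := by
    simpa using (((tendsto_pow_mul_exp_neg_atTop_nhds_zero (n + 3)).const_mul (C ^ 2)).const_mul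
      (1 / 2 + ((n : ℝ) + 1) ^ 2 / 8)).neg
  refine le_of_tendsto hlim ?_
  filter_upwards [hC, eventually_ge_atTop x, eventually_ge_atTop 1] with s hs hxs h1s
  have hs0 : 0 < s := by linarith
  have hus := hpos s hs0
  refine le_trans ?_ ((le_pohozaev hp h1s hus).trans (hanti hx hs0 hxs))
  have h1 : u s ^ 2 ≤ C ^ 2 * exp (-s) := by
    calc u s ^ 2 ≤ (C * exp (-(s / 2))) ^ 2 := by gcongr
      _ = C ^ 2 * exp (-s) := by
        rw [mul_pow, ← exp_nat_mul]; congr 2; push_cast; ring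
  have h2 : s ^ (n + 3) * u s ^ 2 ≤ C ^ 2 * (s ^ (n + 3) * exp (-s)) := by
    calc s ^ (n + 3) * u s ^ 2 ≤ s ^ (n + 3) * (C ^ 2 * exp (-s)) := by gcongr
      _ = _ := by ring
  gcongr

/-- If `u` is bounded by `B t ^ (-θ)` on `[s, 2 s]`, then between `s` and `2 s` there is a point
where the Pohozaev function is bounded by a constant times `s ^ (N - 2 - 2 θ)`, `N = n + 3`. -/
lemma exists_pohozaev_le {n : ℕ} {p B : ℝ} (hp : 1 < p) (hB : 0 < B) {u u' : ℝ → ℝ}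
    (hu : ∀ s > (0:ℝ), HasDerivAt u (u' s) s) (hpos : ∀ s > (0:ℝ), 0 < u s)
    {s : ℝ} (hs : 0 < s) (hbd : ∀ t ∈ Icc s (2 * s), u t ≤ B * t ^ (-thetaP p)) :
    ∃ ξ ∈ Ioo s (2 * s), pohozaev n p u u' ξ ≤
      (2 ^ (n + 3) * (2 * B ^ 2 + B ^ (p + 1) / (p + 1)) + ((n : ℝ) + 1) * 2 ^ (n + 2) * B ^ 2)
        * s ^ ((n : ℝ) + 1 - 2 * thetaP p) := by
  have hθ : 0 < thetaP p := div_pos two_pos (by linarith)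
  obtain ⟨ξ, hξ, hξ'⟩ := exists_hasDerivAt_eq_slope u u' (show s < 2 * s by linarith)
    (fun t ht => (hu t (hs.trans_le ht.1)).continuousAt.continuousWithinAt)
    (fun t ht => hu t (hs.trans ht.1))
  refine ⟨ξ, hξ, ?_⟩
  set q := s ^ (-thetaP p) with hq
  have hq0 : 0 < q := rpow_pos_of_pos hs _
  have hle : ∀ t ∈ Icc s (2 * s), u t ≤ B * q := fun t ht => (hbd t ht).trans
    (mul_le_mul_of_nonneg_left (rpow_le_rpow_of_nonpos hs ht.1 (by linarith)) hB.le)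
  have hξ0 : 0 < ξ := hs.trans hξ.1
  have huξ := hpos ξ hξ0
  have huξle := hle ξ ⟨hξ.1.le, hξ.2.le⟩
  have hd : |u' ξ| ≤ 2 * B * q / s := by
    have h1 := hpos s hs
    have h2 := hpos (2 * s) (by linarith)
    have h3 := hle s ⟨le_rfl, by linarith⟩
    have h4 := hle (2 * s) ⟨by linarith, le_rfl⟩
    rw [hξ', show 2 * s - s = s by ring, abs_div, abs_of_pos hs]
    gcongr
    rw [abs_le]
    constructor <;> linarith
  have hp1 : 0 < p + 1 := by linarith
  have hpq : q ^ (p + 1) = q ^ 2 / s ^ 2 := by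
    have hp' : p - 1 ≠ 0 := by linarith
    have : -thetaP p * (p + 1) = -thetaP p * 2 - 2 := by
      unfold thetaP; field_simp; ring
    rw [hq, ← rpow_mul hs.le, this, rpow_sub hs, rpow_mul hs.le, rpow_two, rpow_two]
  have hup : u ξ ^ (p + 1) ≤ B ^ (p + 1) * (q ^ 2 / s ^ 2) := by
    rw [← hpq, ← mul_rpow hB.le hq0.le]
    gcongr
  have hd2 : u' ξ ^ 2 ≤ (2 * B * q / s) ^ 2 := sq_le_sq' (abs_le.1 hd).1 (abs_le.1 hd).2
  have huu : u ξ * u' ξ ≤ B * q * (2 * B * q / s) :=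
    (mul_le_mul_of_nonneg_left ((le_abs_self _).trans hd) huξ.le).trans
      (mul_le_mul_of_nonneg_right huξle (by positivity))
  have hpow : s ^ ((n : ℝ) + 1 - 2 * thetaP p) = s ^ (n + 1) * q ^ 2 := by
    rw [hq, ← rpow_natCast s (n + 1), ← rpow_natCast (s ^ (-thetaP p)) 2, ← rpow_mul hs.le,
      ← rpow_add hs]
    congr 1
    push_cast
    ring
  rw [hpow]
  unfold pohozaev
  calc _ ≤ (2 * s) ^ (n + 3) * ((2 * B * q / s) ^ 2 / 2 + B ^ (p + 1) * (q ^ 2 / s ^ 2) / (p + 1))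
      + ((n : ℝ) + 1) / 2 * ((2 * s) ^ (n + 2) * (B * q * (2 * B * q / s))) := by
        have h0 : 0 ≤ u ξ ^ 2 / 2 := by positivity
        have hξ2 := hξ.2.le
        have h1 : u' ξ ^ 2 / 2 - u ξ ^ 2 / 2 + u ξ ^ (p + 1) / (p + 1) ≤
            (2 * B * q / s) ^ 2 / 2 + B ^ (p + 1) * (q ^ 2 / s ^ 2) / (p + 1) := by
          have : u ξ ^ (p + 1) / (p + 1) ≤ B ^ (p + 1) * (q ^ 2 / s ^ 2) / (p + 1) := by gcongr
          linarith
        have h2 : ξ ^ (n + 3) ≤ (2 * s) ^ (n + 3) := by gcongr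
        have h3 : ξ ^ (n + 2) ≤ (2 * s) ^ (n + 2) := by gcongr
        refine add_le_add ?_ (mul_le_mul_of_nonneg_left ?_ (by positivity))
        · exact (mul_le_mul_of_nonneg_left h1 (by positivity)).trans
            (mul_le_mul_of_nonneg_right h2 (by positivity))
        · exact (mul_le_mul_of_nonneg_left huu (by positivity)).trans
            (mul_le_mul_of_nonneg_right h3 (by positivity))
    _ = _ := by
        field_simp
        ring

lemma pohozaev_nonpos_of_singular {n : ℕ} {p A : ℝ} (hp : 1 < p)
    (hsup : (n : ℝ) + 5 < (n + 1) * p) (hA : 0 ≤ A) {u u' : ℝ → ℝ}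
    (hanti : AntitoneOn (pohozaev n p u u') (Ioi 0))
    (hu : ∀ s > (0:ℝ), HasDerivAt u (u' s) s) (hpos : ∀ s > (0:ℝ), 0 < u s)
    (hasym : Tendsto (fun s => s ^ thetaP p * u s) (𝓝[>] (0:ℝ)) (𝓝 A)) {x : ℝ} (hx : 0 < x) :
    pohozaev n p u u' x ≤ 0 := by
  have hB : 0 < A + 1 := by linarith
  have hexp : 0 < (n : ℝ) + 1 - 2 * thetaP p := by
    unfold thetaP
    rw [sub_pos, mul_div_assoc', div_lt_iff₀ (by linarith)]
    linarith
  obtain ⟨δ, hδ, hbd⟩ := mem_nhdsGT_iff_exists_Ioo_subset.1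
    (hasym.eventually_lt_const (show A < A + 1 by linarith))
  have hδ0 : 0 < δ := hδ
  set K := 2 ^ (n + 3) * (2 * (A + 1) ^ 2 + (A + 1) ^ (p + 1) / (p + 1))
    + ((n : ℝ) + 1) * 2 ^ (n + 2) * (A + 1) ^ 2
  have hlim : Tendsto (fun s : ℝ => K * s ^ ((n : ℝ) + 1 - 2 * thetaP p)) (𝓝[>] 0) (𝓝 0) := by
    have h := ((continuousAt_rpow_const 0 _ (Or.inr hexp.le)).tendsto.mono_left
      (nhdsWithin_le_nhds (s := Ioi (0:ℝ)))).const_mul K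
    rwa [zero_rpow hexp.ne', mul_zero] at h
  refine ge_of_tendsto hlim ?_
  filter_upwards [Ioo_mem_nhdsGT (half_pos hδ0), Ioo_mem_nhdsGT (half_pos hx)] with s hs hsx
  obtain ⟨ξ, hξ, hle⟩ := exists_pohozaev_le (n := n) hp hB hu hpos hs.1 fun t ht => by
    have ht0 : 0 < t := hs.1.trans_le ht.1
    have h : t ^ thetaP p * u t < A + 1 := hbd ⟨ht0, by linarith [ht.2, hs.2]⟩
    rw [rpow_neg ht0.le, ← div_eq_mul_inv, le_div_iff₀ (rpow_pos_of_pos ht0 _)]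
    linarith
  exact (hanti (hs.1.trans hξ.1) hx (by linarith [hξ.2, hsx.2])).trans hle

/-- nonexistence of a positive entire singular solution decaying at
infinity for `p > p_S`. -/
theorem no_entire_singular_decaying_solution (N : ℕ) (hN : 3 ≤ N) (p : ℝ)
    (hp : 1 < p) (hpS : pSob N < p)
    (u u' u'' : ℝ → ℝ)
    (hu : ∀ s > (0:ℝ), HasDerivAt u (u' s) s)
    (hu' : ∀ s > (0:ℝ), HasDerivAt u' (u'' s) s)
    (hu'' : ContinuousOn u'' (Ioi 0))
    (hode : ∀ s > (0:ℝ), u'' s + ((N : ℝ) - 1) / s * u' s + fNL p (u s) = 0)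
    (hpos : ∀ s > (0:ℝ), 0 < u s)
    (hasym : Tendsto (fun s => s ^ thetaP p * u s) (𝓝[>] (0:ℝ)) (𝓝 (Aconst N p)))
    (hlim : Tendsto u atTop (𝓝 0)) :
    False := by
  obtain ⟨n, rfl⟩ : ∃ n, N = n + 3 := ⟨N - 3, by omega⟩
  have hn : (0:ℝ) < n + 1 := by positivity
  have hsup : (n : ℝ) + 5 < (n + 1) * p := by
    unfold pSob at hpS
    push_cast at hpS
    rw [div_lt_iff₀ (by linarith)] at hpS
    linarith
  have hode' : ∀ s > (0:ℝ), u'' s + ((n : ℝ) + 2) / s * u' s + fNL p (u s) = 0 := by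
    intro s hs
    have h := hode s hs
    push_cast at h
    rwa [show (n : ℝ) + 3 - 1 = n + 2 by ring] at h
  have hA : 0 ≤ Aconst (n + 3) p := ge_of_tendsto hasym <| by
    filter_upwards [self_mem_nhdsWithin] with s hs
    exact mul_nonneg (rpow_nonneg (le_of_lt hs) _) (hpos s hs).le
  have hanti := pohozaev_strictAntiOn hp hsup hu hu' hode' hpos
  have h1 := pohozaev_nonpos_of_singular hp hsup hA hanti.antitoneOn hu hpos hasym one_pos
  have h2 := pohozaev_nonneg_of_decay hp hanti.antitoneOn hpos
    (eventually_le_exp_neg hp hu hu' hode' hpos hlim) two_pos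
  have h3 := hanti (mem_Ioi.2 (one_pos (α := ℝ))) (mem_Ioi.2 two_pos)
    one_lt_two
  linarith
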